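/- arXiv:1605.01557 — 2 statements merged into one kernel-verified Lean document; each statement's English description precedes it below -/
import Mathlib

section
/- (Proposition 2, item 2.) Fix an integer n ≥ 2 and θ ∈ (θ_n, 1), where θ_n = (1 − 1/n)^{n−1}. If x, x' ∈ ∂Λ satisfy T(x) = T(x') = θ and x' is majorized by x, then x' is a permutation of x (there exists a permutation σ of {1,…,n} with x'_i = x_{σ(i)} for all i). In particular, no two points of ∂Λ with throughput θ that are not permutations of each other are comparable in the majorization order. -/
open scoped BigOperators

/-- The worst-case service rate of user `i` under control `p`. -/
noncomputable def rate {n : ℕ} (p : Fin n → ℝ) (i : Fin n) : ℝ :=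
  p i * ∏ j ∈ Finset.univ.erase i, (1 - p j)

/-- The boundary `∂Λ` of `Λ`: rate vectors of controls that are probability vectors. -/
def LamBd (n : ℕ) : Set (Fin n → ℝ) :=
  {x | ∃ p : Fin n → ℝ, (∀ i, p i ∈ Set.Icc (0:ℝ) 1) ∧ (∑ i, p i) = 1 ∧
    ∀ i, x i = rate p i}

/-- `x` is majorized by `y`. -/
def Maj {n : ℕ} (x y : Fin n → ℝ) : Prop :=
  (∑ i, x i = ∑ i, y i) ∧
  ∀ k : ℕ, 1 ≤ k → k ≤ n → ∀ S : Finset (Fin n), S.card = k →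
    ∃ S' : Finset (Fin n), S'.card = k ∧ ∑ i ∈ S, x i ≤ ∑ i ∈ S', y i

/-- The critical throughput `θ_t = (1 - 1/t)^(t-1)`. -/
noncomputable def crit (t : ℕ) : ℝ := (1 - 1 / (t : ℝ)) ^ (t - 1)

open Finset in
/-- Abel summation bound: monotone weights against a sequence with nonnegative partial sums. -/
theorem sum_mul_le_last_mul_sum {m : ℕ} (c d : Fin (m + 1) → ℝ) (hc : Monotone c)
    (hd : ∀ k, 0 ≤ ∑ i ∈ Iic k, d i) :
    ∑ i, c i * d i ≤ c (Fin.last m) * ∑ i, d i := by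
  induction m with
  | zero => simp
  | succ m ih =>
    have hd' : ∀ k, 0 ≤ ∑ i ∈ Iic k, d (Fin.castSucc i) := fun k => by
      have h := hd k.castSucc
      rwa [← Fin.map_castSuccEmb_Iic, sum_map] at h
    have h := ih (fun i => c i.castSucc) (fun i => d i.castSucc)
      (fun i j hij => hc (Fin.castSucc_le_castSucc_iff.2 hij)) hd'
    have hD : 0 ≤ ∑ i : Fin (m + 1), d i.castSucc := by
      have h := hd' (Fin.last m)
      rwa [← Fin.top_eq_last, Iic_top] at h
    have hmul := mul_le_mul_of_nonneg_right (hc (Fin.le_last (Fin.last m).castSucc)) hD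
    rw [Fin.sum_univ_castSucc, Fin.sum_univ_castSucc (f := d)]
    linarith

open Finset in
/-- Among index sets of the same size, an initial segment maximizes the sum of an antitone
sequence. -/
theorem Antitone.sum_le_sum_Iic {n : ℕ} {b : Fin n → ℝ} (hb : Antitone b) (k : Fin n)
    (S : Finset (Fin n)) (hS : S.card = (Iic k).card) :
    ∑ i ∈ S, b i ≤ ∑ i ∈ Iic k, b i := by
  have hS_le : ∑ i ∈ S, (b i - b k) ≤ ∑ i ∈ S, max (b i - b k) 0 :=
    sum_le_sum fun i _ => le_max_left _ _
  have huniv : ∑ i ∈ S, max (b i - b k) 0 ≤ ∑ i, max (b i - b k) 0 :=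
    sum_le_sum_of_subset_of_nonneg (subset_univ S) fun i _ _ => le_max_right _ _
  have hIic : ∑ i, max (b i - b k) 0 = ∑ i ∈ Iic k, (b i - b k) := by
    rw [← sum_subset (subset_univ (Iic k))]
    · refine sum_congr rfl fun i hi => max_eq_left (sub_nonneg.2 (hb (mem_Iic.1 hi)))
    · intro i _ hi
      exact max_eq_right (sub_nonpos.2 (hb (not_le.1 (mt mem_Iic.2 hi)).le))
  have h := hS_le.trans (huniv.trans hIic.le)
  rw [sum_sub_distrib, sum_sub_distrib, sum_const, sum_const, hS] at h
  linarith

/-- The tangent line bound for the logarithm. -/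
theorem log_sub_log_le {a b : ℝ} (ha : 0 < a) (hb : 0 < b) :
    Real.log b - Real.log a ≤ a⁻¹ * (b - a) := by
  have h := Real.log_le_sub_one_of_pos (div_pos hb ha)
  rw [Real.log_div hb.ne' ha.ne'] at h
  have : a⁻¹ * (b - a) = b / a - 1 := by field_simp
  linarith

/-- The strict tangent line bound for the logarithm. -/
theorem log_sub_log_lt {a b : ℝ} (ha : 0 < a) (hb : 0 < b) (hab : b ≠ a) :
    Real.log b - Real.log a < a⁻¹ * (b - a) := by
  have h := Real.log_lt_sub_one_of_pos (div_pos hb ha) (by rwa [ne_eq, div_eq_one_iff_eq ha.ne'])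
  rw [Real.log_div hb.ne' ha.ne'] at h
  have : a⁻¹ * (b - a) = b / a - 1 := by field_simp
  linarith

open Finset in
/-- Strict Karamata inequality for the logarithm on sorted sequences. -/
theorem eq_of_sum_log_le {n : ℕ} {a b : Fin n → ℝ} (ha : Antitone a)
    (ha0 : ∀ i, 0 < a i) (hb0 : ∀ i, 0 < b i)
    (hpart : ∀ k, ∑ i ∈ Iic k, a i ≤ ∑ i ∈ Iic k, b i) (hsum : ∑ i, a i = ∑ i, b i)
    (hlog : ∑ i, Real.log (a i) ≤ ∑ i, Real.log (b i)) : a = b := by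
  cases n with
  | zero => exact Subsingleton.elim _ _
  | succ m =>
    have habel := sum_mul_le_last_mul_sum (fun i => (a i)⁻¹) (fun i => b i - a i)
      (fun i j hij => inv_anti₀ (ha0 j) (ha hij))
      (fun k => by rw [sum_sub_distrib]; linarith [hpart k])
    rw [sum_sub_distrib, hsum, sub_self, mul_zero] at habel
    by_contra hne
    obtain ⟨i, hi⟩ := Function.ne_iff.1 hne
    have hlt := sum_lt_sum (s := univ) (f := fun i => Real.log (b i) - Real.log (a i))
      (fun i _ => log_sub_log_le (ha0 i) (hb0 i))
      ⟨i, mem_univ i, log_sub_log_lt (ha0 i) (hb0 i) (Ne.symm hi)⟩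
    rw [sum_sub_distrib] at hlt
    linarith

/-- Every real vector has an antitone rearrangement. -/
theorem exists_perm_antitone {n : ℕ} (x : Fin n → ℝ) :
    ∃ σ : Equiv.Perm (Fin n), Antitone (x ∘ σ) :=
  ⟨Tuple.sort fun i => -x i, fun _ _ hij =>
    neg_le_neg_iff.1 (Tuple.monotone_sort (fun i => -x i) hij)⟩

open Finset in
/-- Strict Schur-concavity of `x ↦ ∑ log (Q + x i)`. -/
theorem Maj.exists_perm_of_sum_log_le {n : ℕ} {x x' : Fin n → ℝ} (hmaj : Maj x' x) {Q : ℝ}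
    (hx : ∀ i, 0 < Q + x i) (hx' : ∀ i, 0 < Q + x' i)
    (hlog : ∑ i, Real.log (Q + x' i) ≤ ∑ i, Real.log (Q + x i)) :
    ∃ σ : Equiv.Perm (Fin n), ∀ i, x' i = x (σ i) := by
  obtain ⟨ρ, hρ⟩ := exists_perm_antitone x
  obtain ⟨τ, hτ⟩ := exists_perm_antitone x'
  have hpart : ∀ k, ∑ i ∈ Iic k, x' (τ i) ≤ ∑ i ∈ Iic k, x (ρ i) := by
    intro k
    obtain ⟨S', hcard, hle⟩ := hmaj.2 ((Iic k).map τ.toEmbedding).card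
      (by rw [card_map]; exact card_pos.2 ⟨k, mem_Iic.2 le_rfl⟩)
      (by simp) _ rfl
    have hS := hρ.sum_le_sum_Iic k (S'.map ρ.symm.toEmbedding) (by simp [hcard])
    simp only [sum_map, Function.comp_apply, Equiv.coe_toEmbedding, Equiv.apply_symm_apply]
      at hS hle
    exact hle.trans hS
  have heq := eq_of_sum_log_le (a := fun i => Q + x' (τ i)) (b := fun i => Q + x (ρ i))
    (fun i j hij => by simpa using hτ hij) (fun i => hx' _) (fun i => hx _)
    (fun k => by simpa only [sum_add_distrib, add_le_add_iff_left] using hpart k)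
    (by
      rw [sum_add_distrib, sum_add_distrib, Equiv.sum_comp τ x', Equiv.sum_comp ρ x, hmaj.1])
    (by
      rwa [Equiv.sum_comp τ fun i => Real.log (Q + x' i),
        Equiv.sum_comp ρ fun i => Real.log (Q + x i)])
  refine ⟨τ.symm.trans ρ, fun i => ?_⟩
  simpa using congrFun heq (τ.symm i)

open Finset in
/-- A boundary point `x` of throughput below one has a parameter `P` (the idle probability)
minimizing `Q ↦ ∑ log (Q + x i) - (n - 1) log Q`, with minimum value zero. -/
theorem LamBd.exists_sum_log {n : ℕ} {x : Fin n → ℝ} (hx : x ∈ LamBd n)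
    (hT : ∑ i, x i < 1) :
    (∀ i, 0 ≤ x i) ∧
    (∃ P, 0 < P ∧ ∑ i, Real.log (P + x i) = ((n : ℝ) - 1) * Real.log P) ∧
    ∀ Q, 0 < Q → ((n : ℝ) - 1) * Real.log Q ≤ ∑ i, Real.log (Q + x i) := by
  obtain ⟨p, hp, hsum, hrate⟩ := hx
  have hx0 : ∀ i, 0 ≤ x i := fun i => by
    rw [hrate]
    exact mul_nonneg (hp i).1 (prod_nonneg fun j _ => sub_nonneg.2 (hp j).2)
  have hp1 : ∀ i, 0 < 1 - p i := by
    intro i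
    refine sub_pos.2 (lt_of_le_of_ne (hp i).2 fun hi => ?_)
    have hzero : ∑ j ∈ univ.erase i, p j = 0 := by
      linarith [add_sum_erase univ p (mem_univ i)]
    have hxi : x i = 1 := by
      rw [hrate, rate, hi, one_mul]
      refine prod_eq_one fun j hj => ?_
      rw [(sum_eq_zero_iff_of_nonneg fun j _ => (hp j).1).1 hzero j hj, sub_zero]
    linarith [single_le_sum (fun j _ => hx0 j) (mem_univ i)]
  have hP : 0 < ∏ j, (1 - p j) := prod_pos fun j _ => hp1 j
  have hlogP : Real.log (∏ j, (1 - p j)) = ∑ j, Real.log (1 - p j) :=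
    Real.log_prod fun j _ => (hp1 j).ne'
  have hxP : ∀ i, x i * (1 - p i) = (∏ j, (1 - p j)) * p i := fun i => by
    rw [hrate, rate, ← mul_prod_erase univ (fun j => 1 - p j) (mem_univ i)]
    ring
  generalize (∏ j, (1 - p j)) = P at hP hlogP hxP
  have hPx : ∀ i, 0 < P + x i := fun i => add_pos_of_pos_of_nonneg hP (hx0 i)
  have hprod : ∀ i, (P + x i) * (1 - p i) = P := fun i => by linear_combination hxP i
  have hlog : ∀ i, Real.log (P + x i) = Real.log P - Real.log (1 - p i) := fun i => by
    rw [eq_sub_iff_add_eq, ← Real.log_mul (hPx i).ne' (hp1 i).ne', hprod]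
  have hval : ∑ i, Real.log (P + x i) = ((n : ℝ) - 1) * Real.log P := by
    simp only [hlog, sum_sub_distrib, ← hlogP, sum_const, card_univ, Fintype.card_fin,
      nsmul_eq_mul]
    ring
  refine ⟨hx0, ⟨P, hP, hval⟩, fun Q hQ => ?_⟩
  have hle : ∀ i, (1 - p i) * (Real.log Q - Real.log P) ≤
      Real.log (Q + x i) - Real.log (P + x i) := by
    intro i
    have hAM := Real.geom_mean_le_arith_mean2_weighted (hp1 i).le (hp i).1 (div_pos hQ hP).le
      zero_le_one (by ring)
    have hQP : (1 - p i) * (Q / P) + p i * 1 = (Q + x i) / (P + x i) := by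
      have hPi := (hPx i).ne'
      field_simp
      linear_combination Q * hprod i - P * hxP i
    rw [hQP, Real.one_rpow, mul_one] at hAM
    have h := Real.log_le_log (Real.rpow_pos_of_pos (div_pos hQ hP) _) hAM
    rwa [Real.log_rpow (div_pos hQ hP), Real.log_div hQ.ne' hP.ne',
      Real.log_div (add_pos_of_pos_of_nonneg hQ (hx0 i)).ne' (hPx i).ne'] at h
  have h := sum_le_sum fun i (_ : i ∈ univ) => hle i
  rw [← sum_mul, sum_sub_distrib, sum_sub_distrib, hsum, hval, sum_const, card_univ,
    Fintype.card_fin, nsmul_eq_mul, mul_one] at h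
  linarith

theorem no_majorization_on_boundary
    (n : ℕ) (hn : 2 ≤ n) (θ : ℝ) (hθ : θ ∈ Set.Ioo (crit n) 1)
    (x x' : Fin n → ℝ) (hx : x ∈ LamBd n) (hx' : x' ∈ LamBd n)
    (hT : ∑ i, x i = θ) (hT' : ∑ i, x' i = θ) (hmaj : Maj x' x) :
    ∃ σ : Equiv.Perm (Fin n), ∀ i, x' i = x (σ i) := by
  obtain ⟨hx0, -, hmin⟩ := LamBd.exists_sum_log hx (hT ▸ hθ.2)
  obtain ⟨hx0', ⟨P, hP, hval⟩, -⟩ := LamBd.exists_sum_log hx' (hT' ▸ hθ.2)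
  exact hmaj.exists_perm_of_sum_log_le (fun i => add_pos_of_pos_of_nonneg hP (hx0 i))
    (fun i => add_pos_of_pos_of_nonneg hP (hx0' i)) (hval.trans_le (hmin P hP))
end

section
/- (Proposition on α-fairness for n = 2; Proposition 7.) Let n = 2, α ≥ 1, and θ ∈ (0,1). The maximum of F_α(x(p)) over all p ∈ (0,1)² with x_1(p) + x_2(p) = θ is attained, and it equals: for α = 1, −2·log(2/θ) if θ ∈ (0, 1/2] and −2·log(2/(1−θ)) if θ ∈ (1/2, 1); for α > 1, −(2/(α−1))·(2/θ)^{α−1} if θ ∈ (0, 1/2], and −(1/(α−1))·( ((θ + √(2θ−1))/2)^{1−α} + ((θ − √(2θ−1))/2)^{1−α} ) if θ ∈ (1/2, 1). -/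
open scoped BigOperators

/-- The throughput of the rate vector of control `p`. -/
noncomputable def tput {n : ℕ} (p : Fin n → ℝ) : ℝ := ∑ i, rate p i

/-- The `α`-fair utility function. -/
noncomputable def Ualpha (α z : ℝ) : ℝ :=
  if α = 1 then Real.log z else z ^ (1 - α) / (1 - α)

/-- The `α`-fair objective (sum-user utility). -/
noncomputable def Falpha (α : ℝ) {n : ℕ} (x : Fin n → ℝ) : ℝ := ∑ i, Ualpha α (x i)

theorem convexOn_rpow_Ioi_of_nonpos {s : ℝ} (hs : s ≤ 0) :
    ConvexOn ℝ (Set.Ioi 0) fun x : ℝ => x ^ s := by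
  refine ⟨convex_Ioi 0, fun x hx y hy a b ha hb hab => ?_⟩
  have hx' : 0 < x := hx
  have hy' : 0 < y := hy
  have hpos : 0 < a • x + b • y := (convex_Ioi (0 : ℝ)) hx hy ha hb hab
  have hlog := strictConcaveOn_log_Ioi.concaveOn.2 hx hy ha hb hab
  have hexp := convexOn_exp.2 (Set.mem_univ (Real.log x * s)) (Set.mem_univ (Real.log y * s))
    ha hb hab
  simp only [Real.rpow_def_of_pos hpos, Real.rpow_def_of_pos hx', Real.rpow_def_of_pos hy']
  refine le_trans (Real.exp_le_exp.mpr ?_) hexp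
  simp only [smul_eq_mul] at hlog ⊢
  nlinarith [mul_le_mul_of_nonpos_right hlog hs]

theorem concaveOn_Ualpha {α : ℝ} (hα : 1 ≤ α) : ConcaveOn ℝ (Set.Ioi 0) (Ualpha α) := by
  rcases hα.eq_or_lt with rfl | hα
  · have h : Ualpha 1 = Real.log := by
      funext z
      simp [Ualpha]
    exact h ▸ strictConcaveOn_log_Ioi.concaveOn
  · have h : Ualpha α = -fun z : ℝ => (α - 1)⁻¹ • z ^ (1 - α) := by
      funext z
      have h₁ : α - 1 ≠ 0 := by linarith
      have h₂ : 1 - α ≠ 0 := by linarith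
      simp only [Ualpha, if_neg hα.ne', Pi.neg_apply, smul_eq_mul]
      field_simp
      ring
    rw [h]
    exact ((convexOn_rpow_Ioi_of_nonpos (by linarith)).smul
      (inv_nonneg.mpr (by linarith))).neg

/-- Among pairs with a given sum, a pair with larger product is less spread out, so that a concave
function has a larger sum on it. -/
theorem ConcaveOn.add_le_add_of_mul_le_mul {s : Set ℝ} {f : ℝ → ℝ} (hf : ConcaveOn ℝ s f)
    {x y u v : ℝ} (hx : x ∈ s) (hy : y ∈ s) (hadd : x + y = u + v) (hmul : x * y ≤ u * v) :
    f x + f y ≤ f u + f v := by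
  have hu : u ∈ segment ℝ x y := by
    have h : (u - x) * (u - y) ≤ 0 := by
      obtain rfl : v = x + y - u := by linarith
      nlinarith
    rw [segment_eq_uIcc, Set.mem_uIcc]
    rcases mul_nonpos_iff.mp h with ⟨h₁, h₂⟩ | ⟨h₁, h₂⟩
    · exact Or.inl ⟨by linarith, by linarith⟩
    · exact Or.inr ⟨by linarith, by linarith⟩
  obtain ⟨a, b, ha, hb, hab, rfl⟩ := hu
  have hv : v = b • x + a • y := by
    obtain rfl : b = 1 - a := by linarith
    simp only [smul_eq_mul] at hadd ⊢
    linarith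
  have h₁ := hf.2 hx hy ha hb hab
  have h₂ := hf.2 hx hy hb ha (by linarith)
  rw [hv]
  obtain rfl : b = 1 - a := by linarith
  simp only [smul_eq_mul] at h₁ h₂ ⊢
  linarith

theorem rate_fin_two_zero (p : Fin 2 → ℝ) : rate p 0 = p 0 * (1 - p 1) := by
  have h : Finset.univ.erase (0 : Fin 2) = {1} := by decide
  simp [rate, h]

theorem rate_fin_two_one (p : Fin 2 → ℝ) : rate p 1 = p 1 * (1 - p 0) := by
  have h : Finset.univ.erase (1 : Fin 2) = {0} := by decide
  simp [rate, h]

theorem Falpha_rate_le_of_rate_mul_le {α : ℝ} (hα : 1 ≤ α) {p q : Fin 2 → ℝ}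
    (hq : ∀ i, q i ∈ Set.Ioo (0 : ℝ) 1) (hadd : tput q = tput p)
    (hmul : rate q 0 * rate q 1 ≤ rate p 0 * rate p 1) :
    Falpha α (fun i => rate q i) ≤ Falpha α (fun i => rate p i) := by
  simp only [tput, Falpha, Fin.sum_univ_two] at hadd ⊢
  refine (concaveOn_Ualpha hα).add_le_add_of_mul_le_mul ?_ ?_ hadd hmul
  · rw [rate_fin_two_zero]
    exact mul_pos (hq 0).1 (sub_pos.mpr (hq 1).2)
  · rw [rate_fin_two_one]
    exact mul_pos (hq 1).1 (sub_pos.mpr (hq 0).2)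

theorem rate_mul_rate_le_sq_tput (q : Fin 2 → ℝ) :
    rate q 0 * rate q 1 ≤ (tput q / 2) ^ 2 := by
  simp only [tput, Fin.sum_univ_two]
  nlinarith [sq_nonneg (rate q 0 - rate q 1)]

theorem rate_mul_rate_le_sq_one_sub_tput (q : Fin 2 → ℝ) :
    rate q 0 * rate q 1 ≤ ((1 - tput q) / 2) ^ 2 := by
  simp only [tput, Fin.sum_univ_two, rate_fin_two_zero, rate_fin_two_one]
  nlinarith [sq_nonneg (q 0 * q 1 - (1 - q 0) * (1 - q 1))]

theorem alpha_fair_tradeoff_two_users (α : ℝ) (hα : 1 ≤ α)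
    (θ : ℝ) (hθ : θ ∈ Set.Ioo (0:ℝ) 1) :
    ∃ p : Fin 2 → ℝ, (∀ i, p i ∈ Set.Ioo (0:ℝ) 1) ∧ tput p = θ ∧
      (∀ q : Fin 2 → ℝ, (∀ i, q i ∈ Set.Ioo (0:ℝ) 1) → tput q = θ →
        Falpha α (fun i => rate q i) ≤ Falpha α (fun i => rate p i)) ∧
      (α = 1 →
        (θ ≤ 1/2 → Falpha α (fun i => rate p i) = -2 * Real.log (2/θ)) ∧
        (1/2 < θ → Falpha α (fun i => rate p i) = -2 * Real.log (2/(1-θ)))) ∧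
      (1 < α →
        (θ ≤ 1/2 → Falpha α (fun i => rate p i) = -(2/(α-1)) * (2/θ) ^ (α-1)) ∧
        (1/2 < θ → Falpha α (fun i => rate p i) =
          -(1/(α-1)) * (((θ + Real.sqrt (2*θ-1))/2) ^ (1-α) +
            ((θ - Real.sqrt (2*θ-1))/2) ^ (1-α)))) := by
  obtain ⟨hθ₀, hθ₁⟩ := hθ
  rcases le_or_gt θ (1 / 2) with h | h
  · set r := Real.sqrt (1 - 2 * θ)
    have hr : r ^ 2 = 1 - 2 * θ := Real.sq_sqrt (by linarith)
    have hr₀ : 0 ≤ r := Real.sqrt_nonneg _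
    have hr₁ : r < 1 := by nlinarith
    let p : Fin 2 → ℝ := fun _ => (1 - r) / 2
    have hp₀ : rate p 0 = θ / 2 := by
      simp only [rate_fin_two_zero, p]
      linarith
    have hp₁ : rate p 1 = θ / 2 := by
      simp only [rate_fin_two_one, p]
      linarith
    have hp : tput p = θ := by
      simp only [tput, Fin.sum_univ_two, hp₀, hp₁]
      ring
    refine ⟨p, fun i => ⟨by simp only [p]; linarith, by simp only [p]; linarith⟩, hp,
      fun q hq hqθ => Falpha_rate_le_of_rate_mul_le hα hq (hqθ.trans hp.symm) ?_,
      fun hα₁ => ⟨fun _ => ?_, fun h' => absurd h h'.not_ge⟩,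
      fun hα₁ => ⟨fun _ => ?_, fun h' => absurd h h'.not_ge⟩⟩
    · have := rate_mul_rate_le_sq_tput q
      rw [hqθ] at this
      rw [hp₀, hp₁]
      linarith
    · simp only [Falpha, Ualpha, if_pos hα₁, Fin.sum_univ_two, hp₀, hp₁]
      rw [← inv_div θ 2, Real.log_inv]
      ring
    · have h₁ : α - 1 ≠ 0 := by linarith
      have h₂ : 1 - α ≠ 0 := by linarith
      have hpow : (2 / θ) ^ (α - 1) = (θ / 2) ^ (1 - α) := by
        rw [← inv_div θ 2, Real.inv_rpow (by linarith), ← Real.rpow_neg (by linarith), neg_sub]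
      simp only [Falpha, Ualpha, if_neg hα₁.ne', Fin.sum_univ_two, hp₀, hp₁, hpow]
      field_simp
      ring
  · set r := Real.sqrt (2 * θ - 1)
    have hr : r ^ 2 = 2 * θ - 1 := Real.sq_sqrt (by linarith)
    have hr₀ : 0 ≤ r := Real.sqrt_nonneg _
    have hr₁ : r < 1 := by nlinarith
    let p : Fin 2 → ℝ := ![(1 + r) / 2, (1 - r) / 2]
    have hp₀ : rate p 0 = (θ + r) / 2 := by
      simp only [rate_fin_two_zero, p, Matrix.cons_val_zero, Matrix.cons_val_one]
      linarith
    have hp₁ : rate p 1 = (θ - r) / 2 := by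
      simp only [rate_fin_two_one, p, Matrix.cons_val_zero, Matrix.cons_val_one]
      linarith
    have hp : tput p = θ := by
      simp only [tput, Fin.sum_univ_two, hp₀, hp₁]
      ring
    have hmul : (θ + r) / 2 * ((θ - r) / 2) = ((1 - θ) / 2) ^ 2 := by
      linear_combination -hr / 4
    have hadd_pos : 0 < θ + r := by linarith
    have hsub_pos : 0 < θ - r := by nlinarith [sq_pos_of_pos (sub_pos.mpr hr₁)]
    refine ⟨p, Fin.forall_fin_two.mpr ⟨⟨?_, ?_⟩, ⟨?_, ?_⟩⟩, hp,
      fun q hq hqθ => Falpha_rate_le_of_rate_mul_le hα hq (hqθ.trans hp.symm) ?_,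
      fun hα₁ => ⟨fun h' => absurd h h'.not_gt, fun _ => ?_⟩,
      fun hα₁ => ⟨fun h' => absurd h h'.not_gt, fun _ => ?_⟩⟩
    iterate 4
      simp only [p, Matrix.cons_val_zero, Matrix.cons_val_one]
      linarith
    · have := rate_mul_rate_le_sq_one_sub_tput q
      rwa [hqθ, ← hmul, ← hp₀, ← hp₁] at this
    · simp only [Falpha, Ualpha, if_pos hα₁, Fin.sum_univ_two, hp₀, hp₁]
      rw [← Real.log_mul (by positivity) (by positivity), hmul, Real.log_pow,
        ← inv_div (1 - θ) 2, Real.log_inv]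
      push_cast
      ring
    · have h₁ : α - 1 ≠ 0 := by linarith
      have h₂ : 1 - α ≠ 0 := by linarith
      simp only [Falpha, Ualpha, if_neg hα₁.ne', Fin.sum_univ_two, hp₀, hp₁]
      generalize ((θ + r) / 2) ^ (1 - α) = A
      generalize ((θ - r) / 2) ^ (1 - α) = B
      field_simp
      ring
end
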